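/- Let ℓ be a prime power, F_ℓ a finite field with ℓ elements, n ≥ 1, c an even integer, and r ≥ 0 with 2r ≤ c ≤ n. Let V be a fixed r-dimensional subspace of F_ℓ^n. Among all n×n matrices M over F_ℓ with rank(M − Mᵀ) = c, let B be their total number and B_V the number of those with V ⊆ ker M. Then (1 − 2ℓ^{2r−1−n}) · ℓ^{−nr} ≤ B_V/B ≤ (1 + 2ℓ^{r(r+1)/2 − 1 − c}) · ℓ^{−nr}. Equivalently, a uniformly random n×n matrix M with rank(M − Mᵀ) = c (a uniformly random c-symmetric matrix) satisfies 1 − 2ℓ^{2r−1−n} ≤ P[V ⊆ ker M]/ℓ^{−nr} ≤ 1 + 2ℓ^{r(r+1)/2 − 1 − c}. -/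

import Mathlib

open Matrix

/-- The number of `n×n` matrices `M` over `F` with `rank (M - Mᵀ) = c` (i.e. `c`-symmetric
matrices). -/
noncomputable def cSymmetricCount (F : Type) [Field F] (n c : ℕ) : ℕ :=
  Nat.card {M : Matrix (Fin n) (Fin n) F // (M - Mᵀ).rank = c}

/-- The number of `n×n` matrices `M` over `F` with `rank (M - Mᵀ) = c` and `V ⊆ ker M`. -/
noncomputable def cSymmetricVanishingCount (F : Type) [Field F] {n : ℕ} (c : ℕ)
    (V : Submodule F (Fin n → F)) : ℕ :=
  Nat.card {M : Matrix (Fin n) (Fin n) F //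
    (M - Mᵀ).rank = c ∧ V ≤ LinearMap.ker M.mulVecLin}

theorem card_tuples_succ {α : Type*} [Fintype α] (P : ∀ k, (Fin k → α) → Prop) (k : ℕ)
    (hP : ∀ v t, P (k + 1) (Fin.cons v t : Fin (k + 1) → α) → P k t) :
    Nat.card {t // P (k + 1) t} =
      ∑ᶠ t : {t // P k t}, Nat.card {v // P (k + 1) (Fin.cons v t.1 : Fin (k + 1) → α)} := by
  classical
  rw [finsum_eq_sum_of_fintype, ← Nat.card_sigma]
  exact Nat.card_congr
    { toFun := fun t => ⟨⟨Fin.tail t.1, hP (t.1 0) _ (by simpa using t.2)⟩,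
        ⟨t.1 0, by simpa using t.2⟩⟩
      invFun := fun p => ⟨Fin.cons p.2.1 p.1.1, p.2.2⟩
      left_inv := fun t => by simp
      right_inv := fun _ => rfl }

theorem card_tuples_le {α : Type*} [Fintype α] (P : ∀ k, (Fin k → α) → Prop) (a : ℕ → ℕ)
    (r : ℕ) (hP : ∀ k v t, P (k + 1) (Fin.cons v t : Fin (k + 1) → α) → P k t)
    (h : ∀ k < r, ∀ t, P k t →
      Nat.card {v // P (k + 1) (Fin.cons v t : Fin (k + 1) → α)} ≤ a k) :
    Nat.card {t // P r t} ≤ ∏ i ∈ Finset.range r, a i := by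
  classical
  induction r with
  | zero =>
    have : Subsingleton {t // P 0 t} := inferInstance
    simpa using Finite.card_le_one_iff_subsingleton.2 this
  | succ r ih =>
    rw [card_tuples_succ P r (hP r), finsum_eq_sum_of_fintype, Finset.prod_range_succ]
    calc _ ≤ ∑ _t : {t // P r t}, a r := Finset.sum_le_sum fun t _ => h r (by omega) t.1 t.2
      _ = Nat.card {t // P r t} * a r := by simp
      _ ≤ _ := Nat.mul_le_mul_right _ (ih fun k hk => h k (by omega))

theorem le_card_tuples {α : Type*} [Fintype α] (P : ∀ k, (Fin k → α) → Prop) (a : ℕ → ℕ)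
    (r : ℕ) (hP : ∀ k v t, P (k + 1) (Fin.cons v t : Fin (k + 1) → α) → P k t)
    (h0 : ∀ t, P 0 t)
    (h : ∀ k < r, ∀ t, P k t →
      a k ≤ Nat.card {v // P (k + 1) (Fin.cons v t : Fin (k + 1) → α)}) :
    ∏ i ∈ Finset.range r, a i ≤ Nat.card {t // P r t} := by
  classical
  induction r with
  | zero =>
    have : Nonempty {t // P 0 t} := ⟨⟨Fin.elim0, h0 _⟩⟩
    rw [Finset.range_zero, Finset.prod_empty]
    exact Nat.card_pos
  | succ r ih =>
    rw [card_tuples_succ P r (hP r), finsum_eq_sum_of_fintype, Finset.prod_range_succ]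
    calc _ ≤ Nat.card {t // P r t} * a r := Nat.mul_le_mul_right _ (ih fun k hk => h k (by omega))
      _ = ∑ _t : {t // P r t}, a r := by simp
      _ ≤ _ := Finset.sum_le_sum fun t _ => h r (by omega) t.1 t.2

/-- The tuple `t` is totally isotropic for the bilinear form with matrix `A`. -/
def TotallyIsotropic {F : Type} [Field F] {n k : ℕ} (A : Matrix (Fin n) (Fin n) F)
    (t : Fin k → Fin n → F) : Prop :=
  ∀ i j, t i ⬝ᵥ A *ᵥ t j = 0

/-- The matrix `A` is alternating of rank `c`. -/
def IsAlternatingOfRank {F : Type} [Field F] {n : ℕ} (c : ℕ) (A : Matrix (Fin n) (Fin n) F) :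
    Prop :=
  Aᵀ = -A ∧ (∀ i, A i i = 0) ∧ A.rank = c

section
variable {F : Type} [Field F] {n k : ℕ} {c : ℕ} {A : Matrix (Fin n) (Fin n) F}

theorem dotProduct_mulVec_swap {m : Type*} [Fintype m] {A : Matrix m m F} (hA : Aᵀ = -A) (v w : m → F) :
    v ⬝ᵥ A *ᵥ w = -(w ⬝ᵥ A *ᵥ v) := by
  rw [dotProduct_mulVec, ← mulVec_transpose, hA, neg_mulVec, neg_dotProduct, dotProduct_comm]

theorem dotProduct_mulVec_self {m : Type*} [Fintype m] {A : Matrix m m F} (hA : Aᵀ = -A) (hd : ∀ i, A i i = 0) (v : m → F) :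
    v ⬝ᵥ A *ᵥ v = 0 := by
  have hA' : ∀ i j, A j i = -A i j := fun i j => congrFun (congrFun hA i) j
  simp only [dotProduct, mulVec, Finset.mul_sum]
  rw [← Finset.sum_product']
  refine Finset.sum_involution (fun p _ => (p.2, p.1)) ?_ ?_ ?_ ?_
  · rintro ⟨i, j⟩ -
    simp only
    rw [hA' i j]
    ring
  · rintro ⟨i, j⟩ - h
    simp only [ne_eq, Prod.mk.injEq, not_and] at h ⊢
    rintro rfl
    simp [hd] at h
  · simp
  · simp

theorem totallyIsotropic_cons (hA : Aᵀ = -A) (hd : ∀ i, A i i = 0) (v : Fin n → F)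
    (t : Fin k → Fin n → F) :
    TotallyIsotropic A (Fin.cons v t : Fin (k + 1) → Fin n → F) ↔
      TotallyIsotropic A t ∧ ∀ i, t i ⬝ᵥ A *ᵥ v = 0 := by
  simp only [TotallyIsotropic, Fin.forall_fin_succ, Fin.cons_zero, Fin.cons_succ,
    dotProduct_mulVec_self hA hd, true_and]
  constructor
  · rintro ⟨-, h⟩
    exact ⟨fun i j => (h i).2 j, fun i => (h i).1⟩
  · rintro ⟨h, h'⟩
    exact ⟨fun i => by rw [dotProduct_mulVec_swap hA, h', neg_zero], fun i => ⟨h' i, h i⟩⟩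

theorem mulVec_finCons (v : Fin n → F) (t : Fin k → Fin n → F) :
    (fun i => A *ᵥ (Fin.cons v t : Fin (k + 1) → Fin n → F) i) =
      (Fin.cons (A *ᵥ v) fun i => A *ᵥ t i : Fin (k + 1) → Fin n → F) := by
  funext i
  refine Fin.cases ?_ (fun i => ?_) i <;> simp

/-- The orthogonal complement of a tuple. -/
def tuplePerp (A : Matrix (Fin n) (Fin n) F) (t : Fin k → Fin n → F) : Submodule F (Fin n → F) :=
  LinearMap.ker (Matrix.of t * A).mulVecLin

theorem mem_tuplePerp (t : Fin k → Fin n → F) (v : Fin n → F) :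
    v ∈ tuplePerp A t ↔ ∀ i, t i ⬝ᵥ A *ᵥ v = 0 := by
  simp only [tuplePerp, LinearMap.mem_ker, mulVecLin_apply, ← mulVec_mulVec, funext_iff]
  rfl

theorem finrank_tuplePerp (A : Matrix (Fin n) (Fin n) F) (t : Fin k → Fin n → F) :
    Module.finrank F (tuplePerp A t) + (Matrix.of t * A).rank = n := by
  have := LinearMap.finrank_range_add_finrank_ker (Matrix.of t * A).mulVecLin
  simp only [Module.finrank_fin_fun] at this
  rw [add_comm]
  exact this

theorem le_finrank_tuplePerp (A : Matrix (Fin n) (Fin n) F) (t : Fin k → Fin n → F) :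
    n - k ≤ Module.finrank F (tuplePerp A t) := by
  have := finrank_tuplePerp A t
  have h2 := (Matrix.of t * A).rank_le_height
  omega

theorem finrank_tuplePerp_of_linearIndependent (hA : Aᵀ = -A) {t : Fin k → Fin n → F}
    (ht : LinearIndependent F fun i => A *ᵥ t i) :
    Module.finrank F (tuplePerp A t) = n - k := by
  have := finrank_tuplePerp A t
  have h2 : (Matrix.of t * A).rank = k := by
    have h3 : (Matrix.of t * A).row = fun i => -(A *ᵥ t i) := by
      funext i
      change (Matrix.of t * A) i = _
      rw [Matrix.mul_apply_eq_vecMul, ← mulVec_transpose, hA, neg_mulVec]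
      rfl
    have h4 : LinearIndependent F (Matrix.of t * A).row := by
      rw [h3]
      exact ht.neg
    simpa using h4.rank_matrix
  omega

theorem finrank_comap_of_le_range {V W : Type*} [AddCommGroup V] [Module F V] [AddCommGroup W]
    [Module F W] [FiniteDimensional F V] (f : V →ₗ[F] W) (S : Submodule F W)
    (hS : S ≤ LinearMap.range f) :
    Module.finrank F (S.comap f) = Module.finrank F S + Module.finrank F (LinearMap.ker f) := by
  have h := LinearMap.finrank_range_add_finrank_ker (f.domRestrict (S.comap f))
  rw [LinearMap.range_domRestrict, Submodule.map_comap_eq_of_le hS, LinearMap.ker_domRestrict] at h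
  rw [← h]
  congr 1
  exact LinearEquiv.finrank_eq
    (Submodule.comapSubtypeEquivOfLe (LinearMap.ker_le_comap (p := S) f))

theorem finrank_comap_span (hr : A.rank = c) {t : Fin k → Fin n → F}
    (ht : LinearIndependent F fun i => A *ᵥ t i) :
    Module.finrank F ((Submodule.span F (Set.range fun i => A *ᵥ t i)).comap A.mulVecLin)
      = k + (n - c) := by
  have h := LinearMap.finrank_range_add_finrank_ker A.mulVecLin
  simp only [Module.finrank_fin_fun] at h
  have hr' : Module.finrank F (LinearMap.range A.mulVecLin) = c := hr
  rw [finrank_comap_of_le_range, finrank_span_eq_card ht, Fintype.card_fin]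
  · omega
  · rw [Submodule.span_le]
    rintro _ ⟨i, rfl⟩
    exact ⟨t i, rfl⟩

end

section
variable {F : Type} [Field F] [Fintype F] {n k : ℕ} {c : ℕ} {A : Matrix (Fin n) (Fin n) F}

theorem ncard_submodule (S : Submodule F (Fin n → F)) :
    (S : Set (Fin n → F)).ncard = Fintype.card F ^ Module.finrank F S := by
  rw [← Nat.card_coe_set_eq, ← Nat.card_eq_fintype_card]
  exact Module.natCard_eq_pow_finrank

theorem le_card_isotropic (hA : IsAlternatingOfRank c A) (r : ℕ) :
    ∏ i ∈ Finset.range r, (Fintype.card F ^ (n - i) - Fintype.card F ^ i) ≤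
      Nat.card {t : Fin r → Fin n → F // LinearIndependent F t ∧ TotallyIsotropic A t} := by
  obtain ⟨hA, hd, hr⟩ := hA
  refine le_card_tuples (fun k (t : Fin k → Fin n → F) =>
    LinearIndependent F t ∧ TotallyIsotropic A t) _ r ?_ ?_ ?_
  · intro k v t h
    simp only [linearIndependent_finCons, totallyIsotropic_cons hA hd] at h
    exact ⟨h.1.1, h.2.1⟩
  · intro t
    exact ⟨linearIndependent_empty_type, fun i => i.elim0⟩
  · intro k hk t ht
    simp only [linearIndependent_finCons, totallyIsotropic_cons hA hd]
    have h1 : Nat.card {v : Fin n → F // (LinearIndependent F t ∧ v ∉ Submodule.span F (Set.range t))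
        ∧ TotallyIsotropic A t ∧ ∀ i, t i ⬝ᵥ A *ᵥ v = 0} =
        ((tuplePerp A t : Set (Fin n → F)) \ Submodule.span F (Set.range t)).ncard := by
      rw [← Nat.card_coe_set_eq]
      refine Nat.card_congr (Equiv.subtypeEquivRight fun v => ?_)
      simp only [ht.1, ht.2, true_and, Set.mem_sdiff, SetLike.mem_coe, mem_tuplePerp]
      tauto
    rw [h1]
    refine le_trans ?_ (Set.le_ncard_sdiff _ _ (Set.toFinite _))
    rw [ncard_submodule, ncard_submodule, finrank_span_eq_card ht.1, Fintype.card_fin]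
    exact Nat.sub_le_sub_right (Nat.pow_le_pow_right Fintype.card_pos (le_finrank_tuplePerp A t)) _

theorem card_isotropic_le (hA : IsAlternatingOfRank c A) (r : ℕ) :
    Nat.card {t : Fin r → Fin n → F //
      LinearIndependent F (fun i => A *ᵥ t i) ∧ TotallyIsotropic A t} ≤
    ∏ i ∈ Finset.range r, (Fintype.card F ^ (n - i) - Fintype.card F ^ (i + (n - c))) := by
  obtain ⟨hA, hd, hr⟩ := hA
  refine card_tuples_le (fun k (t : Fin k → Fin n → F) =>
    LinearIndependent F (fun i => A *ᵥ t i) ∧ TotallyIsotropic A t) _ r ?_ ?_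
  · intro k v t h
    simp only [mulVec_finCons, linearIndependent_finCons, totallyIsotropic_cons hA hd] at h
    exact ⟨h.1.1, h.2.1⟩
  · intro k hk t ht
    simp only [mulVec_finCons, linearIndependent_finCons, totallyIsotropic_cons hA hd]
    set S := Submodule.span F (Set.range fun i => A *ᵥ t i)
    have h1 : Nat.card {v : Fin n → F // (LinearIndependent F (fun i => A *ᵥ t i) ∧ A *ᵥ v ∉ S)
        ∧ TotallyIsotropic A t ∧ ∀ i, t i ⬝ᵥ A *ᵥ v = 0} =
        ((tuplePerp A t : Set (Fin n → F)) \ S.comap A.mulVecLin).ncard := by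
      rw [← Nat.card_coe_set_eq]
      refine Nat.card_congr (Equiv.subtypeEquivRight fun v => ?_)
      simp only [ht.1, ht.2, true_and, Set.mem_sdiff, SetLike.mem_coe, mem_tuplePerp,
        Submodule.mem_comap, mulVecLin_apply]
      tauto
    have h2 : S.comap A.mulVecLin ≤ tuplePerp A t := by
      intro v hv
      rw [mem_tuplePerp]
      intro i
      rw [Submodule.mem_comap, mulVecLin_apply] at hv
      have h3 : ∀ w ∈ S, t i ⬝ᵥ w = 0 := by
        intro w hw
        induction hw using Submodule.span_induction with
        | mem w hw =>
          obtain ⟨j, rfl⟩ := hw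
          exact ht.2 i j
        | zero => simp
        | add x y _ _ hx hy => rw [dotProduct_add, hx, hy, add_zero]
        | smul a x _ hx => rw [dotProduct_smul, hx, smul_zero]
      exact h3 _ hv
    rw [h1, Set.ncard_sdiff (by exact_mod_cast h2), ncard_submodule, ncard_submodule,
      finrank_comap_span hr ht.1, finrank_tuplePerp_of_linearIndependent hA ht.1]

theorem le_card_linearIndependent_mulVec (hr : A.rank = c) (r : ℕ) :
    ∏ i ∈ Finset.range r, (Fintype.card F ^ n - Fintype.card F ^ (i + (n - c))) ≤
    Nat.card {t : Fin r → Fin n → F // LinearIndependent F (fun i => A *ᵥ t i)} := by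
  refine le_card_tuples (fun k (t : Fin k → Fin n → F) =>
    LinearIndependent F (fun i => A *ᵥ t i)) _ r ?_ ?_ ?_
  · intro k v t h
    simp only [mulVec_finCons, linearIndependent_finCons] at h
    exact h.1
  · intro t
    exact linearIndependent_empty_type
  · intro k hk t ht
    simp only [mulVec_finCons, linearIndependent_finCons]
    set S := Submodule.span F (Set.range fun i => A *ᵥ t i)
    have h1 : Nat.card {v : Fin n → F // (LinearIndependent F (fun i => A *ᵥ t i) ∧ A *ᵥ v ∉ S)} =
        (((⊤ : Submodule F (Fin n → F)) : Set (Fin n → F)) \ S.comap A.mulVecLin).ncard := by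
      rw [← Nat.card_coe_set_eq]
      refine Nat.card_congr (Equiv.subtypeEquivRight fun v => ?_)
      simp [ht]
    rw [h1]
    refine le_trans (le_of_eq ?_) (Set.le_ncard_sdiff _ _ (Set.toFinite _))
    rw [ncard_submodule, ncard_submodule, finrank_comap_span hr ht, finrank_top,
      Module.finrank_fin_fun]

theorem card_isotropic_add_le (hA : IsAlternatingOfRank c A) (r : ℕ) :
    Nat.card {t : Fin r → Fin n → F // LinearIndependent F t ∧ TotallyIsotropic A t} +
      ∏ i ∈ Finset.range r, (Fintype.card F ^ n - Fintype.card F ^ (i + (n - c))) ≤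
    ∏ i ∈ Finset.range r, (Fintype.card F ^ (n - i) - Fintype.card F ^ (i + (n - c))) +
    Nat.card {t : Fin r → Fin n → F // LinearIndependent F t} := by
  have hU := card_isotropic_le hA r
  have hG := le_card_linearIndependent_mulVec hA.2.2 r
  have himp : ∀ t : Fin r → Fin n → F, LinearIndependent F (fun i => A *ᵥ t i) →
      LinearIndependent F t := fun t h => LinearIndependent.of_comp A.mulVecLin h
  set I := {t : Fin r → Fin n → F | LinearIndependent F t ∧ TotallyIsotropic A t}
  set G := {t : Fin r → Fin n → F | LinearIndependent F (fun i => A *ᵥ t i)}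
  set T := {t : Fin r → Fin n → F | LinearIndependent F t}
  have h1 : (I ∩ G).ncard + (I ∪ G).ncard = I.ncard + G.ncard := by
    rw [add_comm]
    exact Set.ncard_union_add_ncard_inter I G
  have h2 : (I ∪ G).ncard ≤ T.ncard := Set.ncard_le_ncard (by
    rintro t (h | h)
    · exact h.1
    · exact himp t h)
  have h3 : I ∩ G = {t | LinearIndependent F (fun i => A *ᵥ t i) ∧ TotallyIsotropic A t} := by
    ext t
    exact ⟨fun h => ⟨h.2, h.1.2⟩, fun h => ⟨⟨himp t h.1, h.2⟩, h.1⟩⟩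
  rw [h3] at h1
  change I.ncard + _ ≤ _ + T.ncard
  change Set.ncard {t | LinearIndependent F (fun i => A *ᵥ t i) ∧ TotallyIsotropic A t} ≤ _ at hU
  change _ ≤ G.ncard at hG
  omega
end

section
variable {F : Type} [Field F] {n r c : ℕ}

theorem exists_linearIndependent_extension {V : Type*} [AddCommGroup V] [Module F V]
    [FiniteDimensional F V] (d r : ℕ) (hd : r + d ≤ Module.finrank F V) (t : Fin r → V)
    (ht : LinearIndependent F t) :
    ∃ s : Fin (r + d) → V, LinearIndependent F s ∧ ∀ i, s (Fin.castAdd d i) = t i := by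
  induction d with
  | zero => exact ⟨t, ht, fun i => rfl⟩
  | succ d ih =>
    obtain ⟨s, hs, hst⟩ := ih (by omega)
    obtain ⟨v, hv⟩ : ∃ v, v ∉ Submodule.span F (Set.range s) := by
      by_contra! h
      have h1 := finrank_span_eq_card hs
      rw [(Submodule.eq_top_iff').2 h, finrank_top, Fintype.card_fin] at h1
      omega
    refine ⟨Fin.snoc s v, linearIndependent_finSnoc.2 ⟨hs, hv⟩, fun i => ?_⟩
    rw [← hst]
    exact Fin.snoc_castSucc (α := fun _ => V) v s (Fin.castAdd d i)

theorem exists_isUnit_col {t : Fin r → Fin n → F} (hr : r ≤ n) (ht : LinearIndependent F t) :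
    ∃ P : Matrix (Fin n) (Fin n) F, IsUnit P.det ∧ ∀ i, P.col (Fin.castLE hr i) = t i := by
  obtain ⟨d, rfl⟩ := Nat.exists_eq_add_of_le hr
  obtain ⟨s, hs, hst⟩ := exists_linearIndependent_extension d r (by simp) t ht
  refine ⟨(Matrix.of s)ᵀ, ?_, fun i => ?_⟩
  · rw [det_transpose, ← isUnit_iff_isUnit_det, ← linearIndependent_rows_iff_isUnit]
    exact hs
  · rw [← hst]
    rfl

/-- Change of basis `A ↦ Pᵀ A P` as a permutation of the square matrices. -/
noncomputable def congruenceEquiv (P : Matrix (Fin n) (Fin n) F) (hP : IsUnit P.det) :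
    Matrix (Fin n) (Fin n) F ≃ Matrix (Fin n) (Fin n) F where
  toFun A := Pᵀ * A * P
  invFun A := (P⁻¹)ᵀ * A * P⁻¹
  left_inv A := by
    have h : (P⁻¹)ᵀ * Pᵀ = 1 := by
      rw [← transpose_mul, mul_nonsing_inv P hP, transpose_one]
    calc (P⁻¹)ᵀ * (Pᵀ * A * P) * P⁻¹ = ((P⁻¹)ᵀ * Pᵀ) * A * (P * P⁻¹) := by
          simp only [Matrix.mul_assoc]
      _ = A := by rw [h, mul_nonsing_inv P hP, Matrix.one_mul, Matrix.mul_one]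
  right_inv A := by
    have h : Pᵀ * (P⁻¹)ᵀ = 1 := by
      rw [← transpose_mul, nonsing_inv_mul P hP, transpose_one]
    calc Pᵀ * ((P⁻¹)ᵀ * A * P⁻¹) * P = (Pᵀ * (P⁻¹)ᵀ) * A * (P⁻¹ * P) := by
          simp only [Matrix.mul_assoc]
      _ = A := by rw [h, nonsing_inv_mul P hP, Matrix.one_mul, Matrix.mul_one]

theorem rank_congruenceEquiv (P : Matrix (Fin n) (Fin n) F) (hP : IsUnit P.det)
    (A : Matrix (Fin n) (Fin n) F) : (congruenceEquiv P hP A).rank = A.rank := by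
  change (Pᵀ * A * P).rank = _
  rw [rank_mul_eq_left_of_isUnit_det _ _ hP,
    rank_mul_eq_right_of_isUnit_det _ _ (by rwa [det_transpose])]

theorem congruenceEquiv_apply_apply (P : Matrix (Fin n) (Fin n) F) (hP : IsUnit P.det)
    (A : Matrix (Fin n) (Fin n) F) (i j : Fin n) :
    congruenceEquiv P hP A i j = P.col i ⬝ᵥ A *ᵥ P.col j := by
  change (Pᵀ * A * P) i j = _
  rw [Matrix.mul_assoc]
  rfl

theorem isAlternatingOfRank_congruenceEquiv {P : Matrix (Fin n) (Fin n) F} (hP : IsUnit P.det)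
    {A : Matrix (Fin n) (Fin n) F} (hA : IsAlternatingOfRank c A) :
    IsAlternatingOfRank c (congruenceEquiv P hP A) := by
  obtain ⟨hA, hd, hr⟩ := hA
  refine ⟨?_, fun i => ?_, ?_⟩
  · change (Pᵀ * A * P)ᵀ = -(Pᵀ * A * P)
    simp [transpose_mul, hA, Matrix.mul_assoc]
  · rw [congruenceEquiv_apply_apply, dotProduct_mulVec_self hA hd]
  · rw [rank_congruenceEquiv, hr]

theorem isAlternatingOfRank_congruenceEquiv_iff {P : Matrix (Fin n) (Fin n) F}
    (hP : IsUnit P.det) {A : Matrix (Fin n) (Fin n) F} :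
    IsAlternatingOfRank c (congruenceEquiv P hP A) ↔ IsAlternatingOfRank c A := by
  refine ⟨fun h => ?_, isAlternatingOfRank_congruenceEquiv hP⟩
  have hP' : IsUnit P⁻¹.det := by
    rw [← isUnit_iff_isUnit_det]
    exact (isUnit_nonsing_inv_iff).2 ((isUnit_iff_isUnit_det P).2 hP)
  have := isAlternatingOfRank_congruenceEquiv hP' h
  have h2 : congruenceEquiv P⁻¹ hP' (congruenceEquiv P hP A) = A :=
    (congruenceEquiv P hP).left_inv A
  rwa [h2] at this

/-- The number of alternating matrices of rank `c` whose upper left `r × r` block vanishes. -/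
noncomputable def alternatingBlockCount (F : Type) [Field F] (n c r : ℕ) : ℕ :=
  Nat.card {A : Matrix (Fin n) (Fin n) F //
    IsAlternatingOfRank c A ∧ ∀ i j : Fin n, i.1 < r → j.1 < r → A i j = 0}

theorem alternatingBlockCount_zero :
    alternatingBlockCount F n c 0 =
      Nat.card {A : Matrix (Fin n) (Fin n) F // IsAlternatingOfRank c A} := by
  simp [alternatingBlockCount]

theorem card_alternating_isotropic (hr : r ≤ n) {t : Fin r → Fin n → F}
    (ht : LinearIndependent F t) :
    Nat.card {A : Matrix (Fin n) (Fin n) F // IsAlternatingOfRank c A ∧ TotallyIsotropic A t} =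
      alternatingBlockCount F n c r := by
  obtain ⟨P, hP, hPt⟩ := exists_isUnit_col hr ht
  refine Nat.card_congr ((congruenceEquiv P hP).subtypeEquiv fun A => ?_)
  rw [isAlternatingOfRank_congruenceEquiv_iff]
  refine and_congr_right fun _ => ?_
  simp only [congruenceEquiv_apply_apply, TotallyIsotropic, ← hPt]
  constructor
  · intro h i j hi hj
    exact h ⟨i, hi⟩ ⟨j, hj⟩
  · intro h i j
    exact h _ _ i.2 j.2

theorem cSymmetricVanishingCount_eq_card_cols (V : Submodule F (Fin n → F))
    (hV : Module.finrank F V = r) :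
    cSymmetricVanishingCount F c V = Nat.card {M : Matrix (Fin n) (Fin n) F //
      (M - Mᵀ).rank = c ∧ ∀ i j : Fin n, j.1 < r → M i j = 0} := by
  have hr : r ≤ n := by
    have := V.finrank_le
    rwa [hV, Module.finrank_fin_fun] at this
  let b := Module.finBasisOfFinrankEq F V hV
  have hb : LinearIndependent F fun i => (b i : Fin n → F) :=
    b.linearIndependent.map' V.subtype V.ker_subtype
  obtain ⟨P, hP, hPt⟩ := exists_isUnit_col hr hb
  refine Nat.card_congr ((congruenceEquiv P hP).subtypeEquiv fun M => ?_)
  have h1 : congruenceEquiv P hP M - (congruenceEquiv P hP M)ᵀ =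
      congruenceEquiv P hP (M - Mᵀ) := by
    change Pᵀ * M * P - (Pᵀ * M * P)ᵀ = Pᵀ * (M - Mᵀ) * P
    simp [transpose_mul, Matrix.mul_assoc, Matrix.mul_sub, Matrix.sub_mul]
  rw [h1, rank_congruenceEquiv]
  refine and_congr_right fun _ => ?_
  have hPT : IsUnit Pᵀ := (isUnit_iff_isUnit_det _).2 (by rwa [det_transpose])
  have h2 : ∀ j, (∀ i, congruenceEquiv P hP M i j = 0) ↔ M *ᵥ P.col j = 0 := by
    intro j
    have h3 : (fun i => congruenceEquiv P hP M i j) = Pᵀ *ᵥ (M *ᵥ P.col j) := by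
      funext i
      rw [congruenceEquiv_apply_apply]
      rfl
    rw [← (mulVec_injective_of_isUnit hPT).eq_iff, mulVec_zero, ← h3, funext_iff]
    rfl
  constructor
  · intro h i j hj
    refine (h2 j).2 ?_ i
    have := h (b ⟨j, hj⟩).2
    rwa [← hPt ⟨j, hj⟩] at this
  · intro h
    have h4 : M.mulVecLin ∘ₗ V.subtype = 0 := by
      refine b.ext fun i => ?_
      have := (h2 (Fin.castLE hr i)).1 fun k => h k _ i.2
      rw [hPt] at this
      exact this
    intro v hv
    exact LinearMap.congr_fun h4 ⟨v, hv⟩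

/-- The matrix with vanishing first `r` columns, antisymmetrization `A`, and entries `f` on and
above the diagonal outside the first `r` rows. -/
def matrixOfUpper (A : Matrix (Fin n) (Fin n) F)
    (f : {p : Fin n × Fin n // r ≤ p.1.1 ∧ p.1 ≤ p.2} → F) : Matrix (Fin n) (Fin n) F :=
  Matrix.of fun i j => if j.1 < r then 0 else if hi : r ≤ i.1 then
      if hij : i ≤ j then f ⟨(i, j), hi, hij⟩
      else if hj : r ≤ j.1 then f ⟨(j, i), hj, le_of_not_ge hij⟩ + A i j else 0
    else A i j

theorem matrixOfUpper_sub_transpose {A : Matrix (Fin n) (Fin n) F} (hA : IsAlternatingOfRank c A)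
    (hA0 : ∀ i j : Fin n, i.1 < r → j.1 < r → A i j = 0)
    (f : {p : Fin n × Fin n // r ≤ p.1.1 ∧ p.1 ≤ p.2} → F) :
    matrixOfUpper A f - (matrixOfUpper A f)ᵀ = A := by
  have hA' : ∀ i j, A j i = -A i j := fun i j => congrFun (congrFun hA.1 i) j
  ext i j
  simp only [matrixOfUpper, Matrix.sub_apply, of_apply, transpose_apply]
  rcases lt_trichotomy i j with hij | rfl | hij
  · have h1 := hij.le
    have h2 := not_le.2 hij
    split_ifs
    all_goals first
      | omega
      | (rw [hA0 i j] <;> first | omega | simp)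
      | (rw [hA' i j]; ring)
      | simp
  · rw [hA.2.1, sub_self]
  · have h1 := hij.le
    have h2 := not_le.2 hij
    split_ifs
    all_goals first
      | omega
      | (rw [hA0 i j] <;> first | omega | simp)
      | (rw [hA' i j]; ring)
      | simp

/-- A matrix with vanishing first `r` columns is determined by its antisymmetrization and its
entries on or above the diagonal outside the first `r` rows. -/
noncomputable def cSymmetricEquiv (F : Type) [Field F] (n c r : ℕ) :
    {M : Matrix (Fin n) (Fin n) F // (M - Mᵀ).rank = c ∧ ∀ i j : Fin n, j.1 < r → M i j = 0} ≃
    {A : Matrix (Fin n) (Fin n) F //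
      IsAlternatingOfRank c A ∧ ∀ i j : Fin n, i.1 < r → j.1 < r → A i j = 0} ×
    ({p : Fin n × Fin n // r ≤ p.1.1 ∧ p.1 ≤ p.2} → F) where
  toFun M := (⟨M.1 - M.1ᵀ, ⟨by simp, by simp, M.2.1⟩, fun i j hi hj => by
    simp [M.2.2 i j hj, M.2.2 j i hi]⟩, fun p => M.1 p.1.1 p.1.2)
  invFun q := ⟨matrixOfUpper q.1.1 q.2, by
    rw [matrixOfUpper_sub_transpose q.1.2.1 q.1.2.2 q.2]
    exact ⟨q.1.2.1.2.2, fun i j hj => by simp [matrixOfUpper, hj]⟩⟩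
  left_inv M := by
    refine Subtype.ext (Matrix.ext fun i j => ?_)
    have h := M.2.2
    simp only [matrixOfUpper, of_apply, Matrix.sub_apply, transpose_apply]
    split_ifs with h1 h2 h3 h4
    · exact (h i j h1).symm
    · rfl
    · ring
    · omega
    · rw [h j i (by omega), sub_zero]
  right_inv q := by
    refine Prod.ext (Subtype.ext (matrixOfUpper_sub_transpose q.1.2.1 q.1.2.2 q.2)) ?_
    funext p
    have h1 := p.2.1
    have h2 : r ≤ p.1.2.1 := h1.trans p.2.2
    simp [matrixOfUpper, h1, not_lt.2 h2, p.2.2]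

theorem card_upper_pairs (n r : ℕ) (hr : r ≤ n) :
    Nat.card {p : Fin n × Fin n // 0 ≤ p.1.1 ∧ p.1 ≤ p.2} =
    Nat.card {p : Fin n × Fin n // r ≤ p.1.1 ∧ p.1 ≤ p.2} + ∑ i ∈ Finset.range r, (n - i) := by
  induction r with
  | zero => simp
  | succ r ih =>
    have hs := ih (by omega)
    rw [Finset.sum_range_succ]
    have : Nat.card {p : Fin n × Fin n // r ≤ p.1.1 ∧ p.1 ≤ p.2} =
      Nat.card {p : Fin n × Fin n // r + 1 ≤ p.1.1 ∧ p.1 ≤ p.2} + (n - r) := by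
      have h1 : ({p : Fin n × Fin n | r ≤ p.1.1 ∧ p.1 ≤ p.2}) =
        {p | r + 1 ≤ p.1.1 ∧ p.1 ≤ p.2} ∪
          (fun j => (⟨r, hr⟩, j)) '' Set.Ici (⟨r, hr⟩ : Fin n) := by
        ext ⟨i, j⟩
        simp only [Set.mem_ofPred_eq, Set.mem_union, Set.mem_image, Set.mem_Ici, Prod.mk.injEq,
          Fin.le_def, Fin.ext_iff]
        constructor
        · rintro ⟨h1, h2⟩
          rcases Nat.lt_or_ge r i with h | h
          · exact Or.inl ⟨h, h2⟩
          · exact Or.inr ⟨j, by omega, by omega, rfl⟩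
        · rintro (h | ⟨k, h⟩) <;> omega
      change Set.ncard {p : Fin n × Fin n | r ≤ p.1.1 ∧ p.1 ≤ p.2} =
        Set.ncard {p : Fin n × Fin n | r + 1 ≤ p.1.1 ∧ p.1 ≤ p.2} + _
      rw [h1, Set.ncard_union_eq, Set.ncard_image_of_injective]
      · congr 1
        simp [Set.ncard_eq_toFinset_card']
      · intro a b h
        simpa using h
      · rw [Set.disjoint_left]
        rintro ⟨i, j⟩ h ⟨k, _, hk⟩
        simp only [Set.mem_ofPred_eq, Prod.mk.injEq, Fin.ext_iff] at h hk
        omega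
    omega

theorem exists_isAlternatingOfRank (hc : Even c) (hcn : c ≤ n) :
    ∃ A : Matrix (Fin n) (Fin n) F, IsAlternatingOfRank c A := by
  obtain ⟨m, rfl⟩ := hc
  let f : Fin m ⊕ Fin m → Fin n := fun s => Fin.castLE hcn (finSumFinEquiv s)
  have hf : Function.Injective f := (Fin.castLE_injective hcn).comp finSumFinEquiv.injective
  let B : Matrix (Fin m ⊕ Fin m) (Fin n) F := (1 : Matrix (Fin n) (Fin n) F).submatrix f id
  have hB : B * Bᵀ = 1 := by
    have h : B * Bᵀ = ((1 : Matrix (Fin n) (Fin n) F) * 1ᵀ).submatrix f f :=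
      (submatrix_mul (1 : Matrix (Fin n) (Fin n) F) 1ᵀ f id f Function.bijective_id).symm
    rw [h, transpose_one, Matrix.mul_one, submatrix_one f hf]
  have hJ : (Matrix.J (Fin m) F)ᵀ = -Matrix.J (Fin m) F := Matrix.J_transpose _ _
  have hJd : ∀ i, Matrix.J (Fin m) F i i = 0 := by
    rintro (i | i) <;> simp [Matrix.J]
  have hJr : (Matrix.J (Fin m) F).rank = m + m := by
    rw [rank_of_isUnit _ ((isUnit_iff_isUnit_det _).2 (Matrix.isUnit_det_J _ _))]
    simp
  refine ⟨Bᵀ * Matrix.J (Fin m) F * B, ?_, fun i => ?_, le_antisymm ?_ ?_⟩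
  · simp [transpose_mul, hJ, Matrix.mul_assoc]
  · have := dotProduct_mulVec_self hJ hJd (B.col i)
    rw [Matrix.mul_assoc]
    exact this
  · rw [← hJr]
    exact (rank_mul_le_left _ _).trans (rank_mul_le_right _ _)
  · have h : Matrix.J (Fin m) F = B * (Bᵀ * Matrix.J (Fin m) F * B) * Bᵀ := by
      calc Matrix.J (Fin m) F = (B * Bᵀ) * Matrix.J (Fin m) F * (B * Bᵀ) := by
            rw [hB, Matrix.one_mul, Matrix.mul_one]
        _ = _ := by simp only [Matrix.mul_assoc]
    calc m + m = (B * (Bᵀ * Matrix.J (Fin m) F * B) * Bᵀ).rank := by rw [← h, hJr]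
      _ ≤ _ := (rank_mul_le_left _ _).trans (rank_mul_le_right _ _)
end

section
variable {F : Type} [Field F] [Fintype F] {n r c : ℕ}

theorem sum_card_isotropic (hr : r ≤ n)
    [Fintype {A : Matrix (Fin n) (Fin n) F // IsAlternatingOfRank c A}] :
    ∑ A : {A : Matrix (Fin n) (Fin n) F // IsAlternatingOfRank c A},
      Nat.card {t : Fin r → Fin n → F // LinearIndependent F t ∧ TotallyIsotropic A.1 t} =
    Nat.card {t : Fin r → Fin n → F // LinearIndependent F t} * alternatingBlockCount F n c r := by
  classical
  let e : (Σ A : {A : Matrix (Fin n) (Fin n) F // IsAlternatingOfRank c A},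
      {t : Fin r → Fin n → F // LinearIndependent F t ∧ TotallyIsotropic A.1 t}) ≃
      Σ t : {t : Fin r → Fin n → F // LinearIndependent F t},
        {A : Matrix (Fin n) (Fin n) F // IsAlternatingOfRank c A ∧ TotallyIsotropic A t.1} :=
    { toFun := fun p => ⟨⟨p.2.1, p.2.2.1⟩, ⟨p.1.1, p.1.2, p.2.2.2⟩⟩
      invFun := fun p => ⟨⟨p.2.1, p.2.2.1⟩, ⟨p.1.1, p.1.2, p.2.2.2⟩⟩
      left_inv := fun _ => rfl
      right_inv := fun _ => rfl }
  rw [← Nat.card_sigma, Nat.card_congr e, Nat.card_sigma,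
    Finset.sum_congr rfl fun t _ => card_alternating_isotropic hr t.2]
  simp

theorem card_linearIndependent_eq (hr : r ≤ n) :
    Nat.card {t : Fin r → Fin n → F // LinearIndependent F t} =
      ∏ i ∈ Finset.range r, (Fintype.card F ^ n - Fintype.card F ^ i) := by
  rw [card_linearIndependent (by simpa using hr), Module.finrank_fin_fun,
    ← Fin.prod_univ_eq_prod_range (fun i => Fintype.card F ^ n - Fintype.card F ^ i)]

theorem le_card_linearIndependent_mul (hr : r ≤ n) :
    (∏ i ∈ Finset.range r, (Fintype.card F ^ (n - i) - Fintype.card F ^ i)) *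
      alternatingBlockCount F n c 0 ≤
    (∏ i ∈ Finset.range r, (Fintype.card F ^ n - Fintype.card F ^ i)) *
      alternatingBlockCount F n c r := by
  classical
  have := Fintype.ofFinite {A : Matrix (Fin n) (Fin n) F // IsAlternatingOfRank c A}
  rw [← card_linearIndependent_eq hr, ← sum_card_isotropic hr, alternatingBlockCount_zero,
    Nat.card_eq_fintype_card, mul_comm, ← smul_eq_mul]
  exact Finset.card_nsmul_le_sum _ _ _ fun A _ => le_card_isotropic A.2 r

theorem card_linearIndependent_mul_le (hr : r ≤ n) :
    (∏ i ∈ Finset.range r, (Fintype.card F ^ n - Fintype.card F ^ i)) *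
      alternatingBlockCount F n c r +
    (∏ i ∈ Finset.range r, (Fintype.card F ^ n - Fintype.card F ^ (i + (n - c)))) *
      alternatingBlockCount F n c 0 ≤
    (∏ i ∈ Finset.range r, (Fintype.card F ^ (n - i) - Fintype.card F ^ (i + (n - c))) +
      ∏ i ∈ Finset.range r, (Fintype.card F ^ n - Fintype.card F ^ i)) *
      alternatingBlockCount F n c 0 := by
  classical
  have := Fintype.ofFinite {A : Matrix (Fin n) (Fin n) F // IsAlternatingOfRank c A}
  rw [← card_linearIndependent_eq hr, ← sum_card_isotropic hr, alternatingBlockCount_zero,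
    Nat.card_eq_fintype_card (α := {A : Matrix (Fin n) (Fin n) F // IsAlternatingOfRank c A})]
  have h := Finset.sum_le_sum fun (A : {A : Matrix (Fin n) (Fin n) F // IsAlternatingOfRank c A})
    (_ : A ∈ Finset.univ) => card_isotropic_add_le A.2 r
  simp only [Finset.sum_add_distrib, Finset.sum_const, Finset.card_univ, smul_eq_mul] at h
  linarith

theorem card_cols_eq :
    Nat.card {M : Matrix (Fin n) (Fin n) F //
      (M - Mᵀ).rank = c ∧ ∀ i j : Fin n, j.1 < r → M i j = 0} =
    alternatingBlockCount F n c r *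
      Fintype.card F ^ Nat.card {p : Fin n × Fin n // r ≤ p.1.1 ∧ p.1 ≤ p.2} := by
  rw [Nat.card_congr (cSymmetricEquiv F n c r), Nat.card_prod, Nat.card_fun,
    Nat.card_eq_fintype_card (α := F)]
  rfl

theorem cSymmetricCount_eq (hr : r ≤ n) :
    cSymmetricCount F n c = alternatingBlockCount F n c 0 *
      (Fintype.card F ^ Nat.card {p : Fin n × Fin n // r ≤ p.1.1 ∧ p.1 ≤ p.2} *
        ∏ i ∈ Finset.range r, Fintype.card F ^ (n - i)) := by
  rw [Finset.prod_pow_eq_pow_sum, ← pow_add, ← card_upper_pairs n r hr, ← card_cols_eq]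
  simp [cSymmetricCount]

end

theorem one_sub_sum_le_prod_one_sub (u : ℕ → ℝ) (r : ℕ) (h0 : ∀ i < r, 0 ≤ u i)
    (h1 : ∀ i < r, u i ≤ 1) :
    1 - ∑ i ∈ Finset.range r, u i ≤ ∏ i ∈ Finset.range r, (1 - u i) := by
  induction r with
  | zero => simp
  | succ r ih =>
    have ih := ih (fun i hi => h0 i (by omega)) (fun i hi => h1 i (by omega))
    rw [Finset.sum_range_succ, Finset.prod_range_succ]
    have h2 : ∏ i ∈ Finset.range r, (1 - u i) ≤ 1 :=
      Finset.prod_le_one (fun i hi => by have := h1 i (by simp at hi; omega); linarith)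
        (fun i hi => by have := h0 i (by simp at hi; omega); linarith)
    nlinarith [h0 r (by omega)]

section
variable {q : ℝ}

theorem sum_zpow_sub_le (hq : 2 ≤ q) (c : ℤ) (r : ℕ) :
    ∑ i ∈ Finset.range r, q ^ ((i : ℤ) - c) ≤ 2 * q ^ ((r : ℤ) - 1 - c) := by
  have hq0 : q ≠ 0 := by positivity
  induction r with
  | zero => simp; positivity
  | succ r ih =>
    rw [Finset.sum_range_succ]
    have h1 : q ^ ((r : ℤ) - c) = q ^ ((r : ℤ) - 1 - c) * q := by
      rw [← zpow_add_one₀ hq0]; congr 1; ring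
    have h2 : ((r + 1 : ℕ) : ℤ) - 1 - c = (r : ℤ) - c := by push_cast; ring
    have h3 : 0 < q ^ ((r : ℤ) - 1 - c) := by positivity
    rw [h2]
    nlinarith

theorem sum_zpow_two_mul_sub_le (hq : 2 ≤ q) (n : ℤ) (r : ℕ) :
    ∑ i ∈ Finset.range r, q ^ (2 * (i : ℤ) - n) ≤ 2 * q ^ (2 * (r : ℤ) - 1 - n) := by
  have hq0 : q ≠ 0 := by positivity
  induction r with
  | zero => simp; positivity
  | succ r ih =>
    rw [Finset.sum_range_succ]
    have h1 : q ^ (2 * (r : ℤ) - n) = q ^ (2 * (r : ℤ) - 1 - n) * q := by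
      rw [← zpow_add_one₀ hq0]; congr 1; ring
    have h2 : q ^ (2 * ((r + 1 : ℕ) : ℤ) - 1 - n) = q ^ (2 * (r : ℤ) - 1 - n) * q * q := by
      rw [← zpow_add_one₀ hq0, ← zpow_add_one₀ hq0]; congr 1; push_cast; ring
    have h3 : 0 < q ^ (2 * (r : ℤ) - 1 - n) := by positivity
    rw [h2, h1]
    have h4 : q ^ (2 * (r : ℤ) - 1 - n) * 2 ≤ q ^ (2 * (r : ℤ) - 1 - n) * q := by gcongr
    nlinarith

variable {n r c : ℕ}

theorem le_prod_pow_sub_sub (hq : 2 ≤ q) (hr : 2 * r ≤ n) :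
    (1 - 2 * q ^ (2 * (r : ℤ) - 1 - n)) * ∏ i ∈ Finset.range r, q ^ (n - i) ≤
      ∏ i ∈ Finset.range r, (q ^ (n - i) - q ^ i) := by
  have hq0 : q ≠ 0 := by positivity
  have h : ∏ i ∈ Finset.range r, (q ^ (n - i) - q ^ i) =
      (∏ i ∈ Finset.range r, (1 - q ^ (2 * (i : ℤ) - n))) * ∏ i ∈ Finset.range r, q ^ (n - i) := by
    rw [← Finset.prod_mul_distrib]
    refine Finset.prod_congr rfl fun i hi => ?_
    rw [Finset.mem_range] at hi
    rw [sub_mul, one_mul, ← zpow_natCast q (n - i), ← zpow_add₀ hq0, ← zpow_natCast q i]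
    congr 2
    omega
  rw [h]
  refine mul_le_mul_of_nonneg_right ?_ (by positivity)
  have h1 := one_sub_sum_le_prod_one_sub (fun i => q ^ (2 * (i : ℤ) - n)) r
    (fun i _ => by positivity) (fun i hi => zpow_le_one_of_nonpos₀ (by linarith) (by omega))
  have h2 := sum_zpow_two_mul_sub_le hq n r
  linarith

theorem mul_prod_pow_sub_le (hq : 2 ≤ q) (hr : r ≤ c) (hc : c ≤ n) :
    (1 - 2 * q ^ ((r : ℤ) - 1 - c)) * ∏ i ∈ Finset.range r, (q ^ n - q ^ i) ≤
      ∏ i ∈ Finset.range r, (q ^ n - q ^ (i + (n - c))) := by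
  have hq0 : q ≠ 0 := by positivity
  have hle : ∀ i < r, 0 ≤ q ^ n - q ^ i := fun i hi =>
    sub_nonneg.2 (pow_le_pow_right₀ (by linarith) (by omega))
  have hz : ∀ i < r, q ^ ((i : ℤ) - c) ≤ 1 := fun i hi =>
    zpow_le_one_of_nonpos₀ (by linarith) (by omega)
  have h : (∏ i ∈ Finset.range r, (1 - q ^ ((i : ℤ) - c))) * ∏ i ∈ Finset.range r, (q ^ n - q ^ i) ≤
      ∏ i ∈ Finset.range r, (q ^ n - q ^ (i + (n - c))) := by
    rw [← Finset.prod_mul_distrib]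
    refine Finset.prod_le_prod (fun i hi => ?_) fun i hi => ?_
    · rw [Finset.mem_range] at hi
      exact mul_nonneg (sub_nonneg.2 (hz i hi)) (hle i hi)
    · rw [Finset.mem_range] at hi
      have h1 : q ^ (i + (n - c)) = q ^ ((i : ℤ) - c) * q ^ n := by
        rw [← zpow_natCast q n, ← zpow_add₀ hq0, ← zpow_natCast]
        congr 1
        omega
      rw [h1]
      have h2 : 0 ≤ (1 - q ^ ((i : ℤ) - c)) * q ^ i :=
        mul_nonneg (sub_nonneg.2 (hz i hi)) (by positivity)
      linarith
  refine le_trans (mul_le_mul_of_nonneg_right ?_ (Finset.prod_nonneg fun i hi =>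
    hle i (Finset.mem_range.1 hi))) h
  have h1 := one_sub_sum_le_prod_one_sub (fun i => q ^ ((i : ℤ) - c)) r
    (fun i _ => by positivity) hz
  have h2 := sum_zpow_sub_le hq c r
  linarith

theorem prod_pow_sub_sub_mul_le (hq : 2 ≤ q) (hr : 2 * r ≤ c) (hc : c ≤ n) :
    (∏ i ∈ Finset.range r, (q ^ (n - i) - q ^ (i + (n - c)))) * q ^ (n * r) ≤
      (∏ i ∈ Finset.range r, q ^ (n - i)) * ∏ i ∈ Finset.range r, (q ^ n - q ^ i) := by
  have h : q ^ (n * r) = ∏ _i ∈ Finset.range r, q ^ n := by simp [pow_mul]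
  rw [h, ← Finset.prod_mul_distrib, ← Finset.prod_mul_distrib]
  refine Finset.prod_le_prod (fun i hi => ?_) fun i hi => ?_
  · rw [Finset.mem_range] at hi
    exact mul_nonneg (sub_nonneg.2 (pow_le_pow_right₀ (by linarith) (by omega))) (by positivity)
  · rw [Finset.mem_range] at hi
    have h1 : q ^ (n - i) * q ^ i = q ^ n := by
      rw [← pow_add]
      congr 1
      omega
    have h2 : q ^ n ≤ q ^ (i + (n - c)) * q ^ n :=
      le_mul_of_one_le_left (by positivity) (one_le_pow₀ (by linarith))
    rw [sub_mul, mul_sub, h1]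
    linarith

theorem pow_mul_eq_prod_mul (hr : r ≤ n) :
    q ^ (n * r) = (∏ i ∈ Finset.range r, q ^ (n - i)) * q ^ (r * (r - 1) / 2) := by
  rw [← Finset.sum_range_id, ← Finset.prod_pow_eq_pow_sum, ← Finset.prod_mul_distrib, pow_mul,
    Finset.prod_congr rfl (g := fun _ => q ^ n)]
  · simp
  · intro i hi
    rw [Finset.mem_range] at hi
    rw [← pow_add]
    congr 1
    omega

theorem prod_pow_sub_le (hq : 2 ≤ q) (hr : r ≤ n) :
    ∏ i ∈ Finset.range r, (q ^ n - q ^ i) ≤ q ^ (n * r) := by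
  have h : q ^ (n * r) = ∏ _i ∈ Finset.range r, q ^ n := by simp [pow_mul]
  rw [h]
  refine Finset.prod_le_prod (fun i hi => ?_) fun i hi => ?_
  · rw [Finset.mem_range] at hi
    exact sub_nonneg.2 (pow_le_pow_right₀ (by linarith) (by omega))
  · exact sub_le_self _ (by positivity)

theorem prod_pow_sub_pos (hq : 2 ≤ q) (hr : r ≤ n) :
    0 < ∏ i ∈ Finset.range r, (q ^ n - q ^ i) := by
  refine Finset.prod_pos fun i hi => ?_
  rw [Finset.mem_range] at hi
  exact sub_pos.2 (pow_lt_pow_right₀ (by linarith) (by omega))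

theorem add_sub_mul_pow_le (hq : 2 ≤ q) (hr : 2 * r ≤ c) (hc : c ≤ n) :
    (∏ i ∈ Finset.range r, (q ^ (n - i) - q ^ (i + (n - c))) +
      ∏ i ∈ Finset.range r, (q ^ n - q ^ i) -
      ∏ i ∈ Finset.range r, (q ^ n - q ^ (i + (n - c)))) * q ^ (n * r) ≤
    (1 + 2 * q ^ (((r * (r + 1) / 2 : ℕ) : ℤ) - 1 - c)) *
      ((∏ i ∈ Finset.range r, q ^ (n - i)) * ∏ i ∈ Finset.range r, (q ^ n - q ^ i)) := by
  have hq0 : q ≠ 0 := by positivity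
  have h1 := prod_pow_sub_sub_mul_le hq hr hc
  have h2 := mul_prod_pow_sub_le (n := n) (r := r) (c := c) hq (by omega) hc
  have h3 : q ^ (((r * (r + 1) / 2 : ℕ) : ℤ) - 1 - c) =
      q ^ (r * (r - 1) / 2) * q ^ ((r : ℤ) - 1 - c) := by
    rw [← zpow_natCast, ← zpow_add₀ hq0]
    congr 1
    have h4 : r * (r + 1) / 2 = r * (r - 1) / 2 + r := by
      have h5 : r * (r + 1) = r * (r - 1) + r * 2 := by
        cases r
        · rfl
        · simp only [Nat.add_sub_cancel]
          ring
      rw [h5, Nat.add_mul_div_right _ _ (by norm_num)]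
    rw [h4]
    push_cast
    ring
  have h4 := pow_mul_eq_prod_mul (q := q) (n := n) (r := r) (by omega)
  set T := ∏ i ∈ Finset.range r, (q ^ n - q ^ i)
  set D := ∏ i ∈ Finset.range r, q ^ (n - i)
  set G := ∏ i ∈ Finset.range r, (q ^ n - q ^ (i + (n - c)))
  have h5 : (T - G) * q ^ (n * r) ≤ 2 * q ^ ((r : ℤ) - 1 - c) * T * q ^ (n * r) :=
    mul_le_mul_of_nonneg_right (by linarith) (by positivity)
  rw [h3]
  have h6 : 2 * q ^ ((r : ℤ) - 1 - c) * T * q ^ (n * r) =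
      2 * (q ^ (r * (r - 1) / 2) * q ^ ((r : ℤ) - 1 - c)) * (D * T) := by
    rw [h4]
    ring
  linarith

end

theorem prod_cast_pow_sub (ℓ r : ℕ) (hℓ : 0 < ℓ) (a b : ℕ → ℕ) (h : ∀ i < r, b i ≤ a i) :
    ((∏ i ∈ Finset.range r, (ℓ ^ a i - ℓ ^ b i) : ℕ) : ℝ) =
      ∏ i ∈ Finset.range r, ((ℓ : ℝ) ^ a i - (ℓ : ℝ) ^ b i) := by
  rw [Nat.cast_prod]
  refine Finset.prod_congr rfl fun i hi => ?_
  rw [Nat.cast_sub (Nat.pow_le_pow_right hℓ (h i (Finset.mem_range.1 hi)))]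
  push_cast
  rfl

/-- **Probability that a random `c`-symmetric matrix vanishes on a fixed subspace.**
For `c` even, `2r ≤ c ≤ n`, and `V` a fixed `r`-dimensional subspace of `F_ℓ^n`, the
proportion `B_V / B` of `n×n` matrices `M` with `rank (M - Mᵀ) = c` satisfying `V ⊆ ker M`
obeys `(1 - 2ℓ^{2r-1-n})·ℓ^{-nr} ≤ B_V/B ≤ (1 + 2ℓ^{r(r+1)/2-1-c})·ℓ^{-nr}`. -/
theorem cSymmetric_vanishing_probability (F : Type) [Field F] [Fintype F]
    (ℓ n c r : ℕ) (hℓ : Fintype.card F = ℓ) (hn : 1 ≤ n)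
    (hceven : Even c) (hrc : 2 * r ≤ c) (hcn : c ≤ n)
    (V : Submodule F (Fin n → F)) (hV : Module.finrank F V = r) :
    ((1 - 2 * (ℓ : ℝ) ^ (2 * (r : ℤ) - 1 - n)) * (ℓ : ℝ) ^ (-((n * r : ℕ) : ℤ))
      ≤ (cSymmetricVanishingCount F c V : ℝ) / (cSymmetricCount F n c : ℝ)) ∧
    ((cSymmetricVanishingCount F c V : ℝ) / (cSymmetricCount F n c : ℝ)
      ≤ (1 + 2 * (ℓ : ℝ) ^ (((r * (r + 1) / 2 : ℕ) : ℤ) - 1 - c)) *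
        (ℓ : ℝ) ^ (-((n * r : ℕ) : ℤ))) := by
  subst hℓ
  have hrn : r ≤ n := by omega
  set q : ℝ := (Fintype.card F : ℝ) with hqdef
  have hq : 2 ≤ q := by
    rw [hqdef]
    exact_mod_cast Nat.succ_le_of_lt (Fintype.one_lt_card (α := F))
  have hc0 : 0 < Fintype.card F := Fintype.card_pos
  obtain ⟨A, hA⟩ := exists_isAlternatingOfRank (F := F) hceven hcn
  have hR : (0 : ℝ) < alternatingBlockCount F n c 0 := by
    have : Nonempty {A : Matrix (Fin n) (Fin n) F // IsAlternatingOfRank c A} := ⟨⟨A, hA⟩⟩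
    rw [alternatingBlockCount_zero]
    exact_mod_cast Nat.card_pos
  have hL := le_card_linearIndependent_mul (F := F) (c := c) hrn
  have hU := card_linearIndependent_mul_le (F := F) (c := c) hrn
  rify at hL hU
  rw [← Nat.cast_prod, ← Nat.cast_prod] at hL
  rw [← Nat.cast_prod, ← Nat.cast_prod, ← Nat.cast_prod] at hU
  rw [prod_cast_pow_sub _ _ hc0 (fun i => n - i) (fun i => i) (fun i hi => by omega),
    prod_cast_pow_sub _ _ hc0 (fun _ => n) (fun i => i) (fun i hi => by omega)] at hL
  rw [prod_cast_pow_sub _ _ hc0 (fun i => n - i) (fun i => i + (n - c)) (fun i hi => by omega),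
    prod_cast_pow_sub _ _ hc0 (fun _ => n) (fun i => i + (n - c)) (fun i hi => by omega),
    prod_cast_pow_sub _ _ hc0 (fun _ => n) (fun i => i) (fun i hi => by omega)] at hU
  have hratio : (cSymmetricVanishingCount F c V : ℝ) / (cSymmetricCount F n c : ℝ) =
      alternatingBlockCount F n c r /
        (alternatingBlockCount F n c 0 * ∏ i ∈ Finset.range r, q ^ (n - i)) := by
    rw [cSymmetricVanishingCount_eq_card_cols V hV, card_cols_eq, cSymmetricCount_eq hrn]
    push_cast
    rw [mul_left_comm, mul_comm (alternatingBlockCount F n c r : ℝ)]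
    exact mul_div_mul_left _ _ (by positivity)
  have hL' := le_prod_pow_sub_sub (q := q) (n := n) (r := r) hq (by omega)
  have hU' := add_sub_mul_pow_le (q := q) hq hrc hcn
  have hT := prod_pow_sub_le (q := q) hq hrn
  have hT0 := prod_pow_sub_pos (q := q) hq hrn
  have hD : 0 < ∏ i ∈ Finset.range r, q ^ (n - i) := by positivity
  rw [hratio, _root_.zpow_neg, zpow_natCast, ← div_eq_mul_inv, ← div_eq_mul_inv]
  simp only [← hqdef] at hL hU
  set T := ∏ i ∈ Finset.range r, (q ^ n - q ^ i)
  set D := ∏ i ∈ Finset.range r, q ^ (n - i)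
  set R : ℝ := (alternatingBlockCount F n c 0 : ℝ)
  set K : ℝ := (alternatingBlockCount F n c r : ℝ)
  have hK : 0 ≤ K := Nat.cast_nonneg _
  have hqn : 0 < q ^ (n * r) := by positivity
  constructor
  · rw [div_le_div_iff₀ hqn (by positivity)]
    calc _ = (1 - 2 * q ^ (2 * (r : ℤ) - 1 - n)) * D * R := by ring
      _ ≤ _ := mul_le_mul_of_nonneg_right hL' hR.le
      _ ≤ T * K := hL
      _ ≤ q ^ (n * r) * K := mul_le_mul_of_nonneg_right hT hK
      _ = _ := mul_comm _ _
  · rw [div_le_div_iff₀ (by positivity) hqn]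
    refine le_of_mul_le_mul_left ?_ hT0
    have h1 := mul_le_mul_of_nonneg_right hU' hR.le
    have h2 := mul_le_mul_of_nonneg_right hU hqn.le
    linarith
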